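/- Let A₀ be a finite set, let H be the free group with basis A₀ ∪ {a,b,u,y}, let A ≤ H be the subgroup generated by A₀ ∪ {a,b,u}, let v = a·y·b·y·a·y⁻¹·b·y⁻¹ ∈ H, and let F be the HNN extension F = ⟨H, t | t⁻¹ u t = v⟩ of H along the isomorphism ⟨u⟩ → ⟨v⟩ sending u to v. Then F is a free group of rank |A₀| + 4, and: every group endomorphism f of F fixing A pointwise is an automorphism of F; moreover, if the restriction of f to H is not the identity of H, then f(y) = y⁻¹. -/

import Mathlib

open FirstOrder Filter

/-! Common definitions: the first-order language of groups, algebraic/definable closures,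
free products, amalgams, HNN extensions, etc. -/

/-- Function symbols of the language of groups: `1`, `⁻¹`, `·`. -/
inductive GrpFunc : ℕ → Type
  | one : GrpFunc 0
  | inv : GrpFunc 1
  | mul : GrpFunc 2

/-- The first-order language of groups `L = {·, ⁻¹, 1}` (no relation symbols). -/
def grpLang : FirstOrder.Language := ⟨GrpFunc, fun _ => Empty⟩

/-- Every group is a `grpLang`-structure in the natural way. -/
instance grpStructure (G : Type*) [Group G] : grpLang.Structure G where
  funMap {_} f := match f with
    | .one => fun _ => (1 : G)
    | .inv => fun x => (x 0)⁻¹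
    | .mul => fun x => x 0 * x 1
  RelMap {_} r := Empty.elim r

/-- A formula is existential if it is obtained from a quantifier-free formula by
prefixing existential quantifiers. -/
def IsExistential {L : FirstOrder.Language} {α : Type*} (φ : L.Formula α) : Prop :=
  ∃ (n : ℕ) (ψ : L.BoundedFormula α n), ψ.IsQF ∧ φ = ψ.exs

section ModelTheory

variable (L : FirstOrder.Language) {M : Type*} [L.Structure M]

/-- The algebraic closure of a set of parameters `A` in an `L`-structure `M`:
elements satisfying, together with only finitely many other elements, some formula
with parameters from `A`. -/
def Lacl (A : Set M) : Set M :=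
  {b | ∃ φ : L.Formula (↥A ⊕ Fin 1),
    {c : M | φ.Realize (Sum.elim Subtype.val fun _ => c)}.Finite ∧
    φ.Realize (Sum.elim Subtype.val fun _ => b)}

/-- The definable closure of a set of parameters `A` in an `L`-structure `M`. -/
def Ldcl (A : Set M) : Set M :=
  {b | ∃ φ : L.Formula (↥A ⊕ Fin 1),
    {c : M | φ.Realize (Sum.elim Subtype.val fun _ => c)} = {b}}

/-- The existential algebraic closure of `A` in `M`. -/
def LaclE (A : Set M) : Set M :=
  {b | ∃ φ : L.Formula (↥A ⊕ Fin 1), IsExistential φ ∧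
    {c : M | φ.Realize (Sum.elim Subtype.val fun _ => c)}.Finite ∧
    φ.Realize (Sum.elim Subtype.val fun _ => b)}

/-- The existential definable closure of `A` in `M`. -/
def LdclE (A : Set M) : Set M :=
  {b | ∃ φ : L.Formula (↥A ⊕ Fin 1), IsExistential φ ∧
    {c : M | φ.Realize (Sum.elim Subtype.val fun _ => c)} = {b}}

end ModelTheory

section GroupDefs

variable {G : Type*} [Group G]

/-- Algebraic closure in a group, w.r.t. the language of groups. -/
def acl (A : Set G) : Set G := Lacl grpLang A

/-- Definable closure in a group, w.r.t. the language of groups. -/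
def dcl (A : Set G) : Set G := Ldcl grpLang A

/-- Existential algebraic closure in a group. -/
def aclE (A : Set G) : Set G := LaclE grpLang A

/-- Existential definable closure in a group. -/
def dclE (A : Set G) : Set G := LdclE grpLang A

/-- Restricted algebraic closure: elements with finite orbit under automorphisms
of `G` fixing `A` pointwise. -/
def racl (A : Set G) : Set G :=
  {g | {x : G | ∃ f : G ≃* G, (∀ a ∈ A, f a = a) ∧ f g = x}.Finite}

/-- Restricted definable closure: elements fixed by every automorphism of `G`
fixing `A` pointwise. -/
def rdcl (A : Set G) : Set G :=
  {g | ∀ f : G ≃* G, (∀ a ∈ A, f a = a) → f g = g}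

/-- A set of group elements is nonabelian (contains two non-commuting elements). -/
def Nonabelian (A : Set G) : Prop := ∃ x ∈ A, ∃ y ∈ A, x * y ≠ y * x

/-- `F` is a free group of finite rank. -/
def IsFreeOfFiniteRank (F : Type*) [Group F] : Prop :=
  ∃ n : ℕ, Nonempty (F ≃* FreeGroup (Fin n))

/-- `G` is the internal free product of its subgroups `H` and `K`: the canonical
homomorphism from the abstract free product `H ∗ K` to `G` is an isomorphism. -/
def InternalFreeProduct (H K : Subgroup G) : Prop :=
  Function.Bijective (Monoid.Coprod.lift H.subtype K.subtype)

/-- `G` is freely indecomposable relative to its subgroup `A`. -/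
def FreelyIndecomposableRel (A : Subgroup G) : Prop :=
  ¬ ∃ G₁ G₂ : Subgroup G, G₁ ≠ ⊥ ∧ G₂ ≠ ⊥ ∧ A ≤ G₁ ∧ InternalFreeProduct G₁ G₂

/-- `B` is a free factor of the subgroup `K`: there is `L` such that the canonical
homomorphism from the abstract free product `B ∗ L` to the ambient group is injective
with image exactly `K`. -/
def IsFreeFactorOf (B K : Subgroup G) : Prop :=
  ∃ L : Subgroup G,
    Function.Injective (Monoid.Coprod.lift B.subtype L.subtype) ∧
    (Monoid.Coprod.lift B.subtype L.subtype).range = K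

/-- `K'` is the amalgamated free product `K ∗_C B` inside the ambient group `G`:
the canonical homomorphism from the abstract amalgamated product (pushout) of `K` and
`B` over `C` to `G` is injective with image exactly `K'`. -/
def IsAmalgamOf (K B C : Subgroup G) (hCK : C ≤ K) (hCB : C ≤ B) (K' : Subgroup G) : Prop :=
  ∃ ℓ : Monoid.PushoutI
      (fun i : Bool =>
        (Subgroup.inclusion (show C ≤ cond i K B by cases i <;> assumption) :
          ↥C →* ↥(cond i K B))) →* G,
    (∀ i : Bool, ℓ.comp (Monoid.PushoutI.of i) = (cond i K B).subtype) ∧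
    Function.Injective ℓ ∧ ℓ.range = K'

/-- `K'` is the HNN extension of `K` along `φ : C ≃* D` inside the ambient group `G`:
the canonical homomorphism from the abstract HNN extension of `K` along `φ` to `G` is
injective with image exactly `K'` (and is the inclusion on `K`). -/
def IsHNNOf (K : Subgroup G) {C D : Subgroup ↥K} (φ : ↥C ≃* ↥D) (K' : Subgroup G) : Prop :=
  ∃ ℓ : HNNExtension ↥K C D φ →* G,
    ℓ.comp HNNExtension.of = K.subtype ∧ Function.Injective ℓ ∧ ℓ.range = K'

/-- One constructibility step: `K'` is an amalgamated free product of `K` with some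
subgroup over a cyclic subgroup, or an HNN extension of `K` along an isomorphism of two
cyclic subgroups of `K`. -/
def ConstructStep (K K' : Subgroup G) : Prop :=
  (∃ (B C : Subgroup G) (hCK : C ≤ K) (hCB : C ≤ B),
      (∃ c : G, C = Subgroup.zpowers c) ∧ B ≤ K' ∧ K ≤ K' ∧ IsAmalgamOf K B C hCK hCB K')
  ∨ (∃ (C D : Subgroup ↥K) (φ : ↥C ≃* ↥D),
      (∃ c : ↥K, C = Subgroup.zpowers c) ∧ (∃ d : ↥K, D = Subgroup.zpowers d) ∧ IsHNNOf K φ K')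

/-- `B` is constructible from `A` by a finite sequence of amalgamated free products and
HNN-extensions along cyclic subgroups. -/
def ConstructibleFrom (A B : Subgroup G) : Prop := Relation.ReflTransGen ConstructStep A B

/-- The rank of a subgroup: the least cardinality of a generating set. For (subgroups of)
free groups this is the cardinality of a basis. -/
noncomputable def srank (H : Subgroup G) : Cardinal :=
  sInf {c : Cardinal | ∃ S : Set G, Subgroup.closure S = H ∧ c = Cardinal.mk ↥S}

/-- `M` is a maximal abelian subgroup. -/
def IsMaxAbelian (M : Subgroup G) : Prop :=
  (∀ x ∈ M, ∀ y ∈ M, x * y = y * x) ∧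
  ∀ N : Subgroup G, (∀ x ∈ N, ∀ y ∈ N, x * y = y * x) → M ≤ N → M = N

/-- `M` is a maximal abelian subgroup of the subgroup `H`. -/
def IsMaxAbelianIn (M H : Subgroup G) : Prop :=
  M ≤ H ∧ (∀ x ∈ M, ∀ y ∈ M, x * y = y * x) ∧
  ∀ N : Subgroup G, N ≤ H → (∀ x ∈ N, ∀ y ∈ N, x * y = y * x) → M ≤ N → M = N

/-- `M` is a malnormal subgroup: `gMg⁻¹ ∩ M = 1` for every `g ∉ M`. -/
def Malnormal (M : Subgroup G) : Prop :=
  ∀ g : G, g ∉ M → ∀ x ∈ M, g * x * g⁻¹ ∈ M → x = 1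

/-- A group is CSA if every maximal abelian subgroup is malnormal. -/
def IsCSA (G : Type*) [Group G] : Prop := ∀ M : Subgroup G, IsMaxAbelian M → Malnormal M

/-- Every abelian subgroup of `G` is cyclic. -/
def AbelianSubgroupsCyclic (G : Type*) [Group G] : Prop :=
  ∀ H : Subgroup G, (∀ x ∈ H, ∀ y ∈ H, x * y = y * x) → ∃ g : G, H = Subgroup.zpowers g

/-- `G` is equationally noetherian: every system of equations over `G` in finitely many
variables is equivalent to a finite subsystem. -/
def EqNoetherian (G : Type*) [Group G] : Prop :=
  ∀ n : ℕ, 0 < n → ∀ S : Set (Monoid.Coprod G (FreeGroup (Fin n))),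
    ∃ S₀ : Set (Monoid.Coprod G (FreeGroup (Fin n))), S₀ ⊆ S ∧ S₀.Finite ∧
      ∀ f : Monoid.Coprod G (FreeGroup (Fin n)) →* G,
        f.comp Monoid.Coprod.inl = MonoidHom.id G →
        ((∀ s ∈ S₀, f s = 1) ↔ ∀ s ∈ S, f s = 1)

/-- A group homomorphism is elementary w.r.t. the language of groups: it preserves
and reflects all first-order formulas. -/
def ElementaryEmb {H K : Type*} [Group H] [Group K] (e : H →* K) : Prop :=
  ∀ (n : ℕ) (φ : grpLang.Formula (Fin n)) (v : Fin n → H),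
    (φ.Realize fun i => e (v i)) ↔ φ.Realize v

/-- The inclusion of the subgroup `H` is an elementary embedding; i.e. the ambient group
is an elementary extension of `H`. -/
def ElementarySub (H : Subgroup G) : Prop := ElementaryEmb H.subtype

/-- A sequence of homomorphisms is stable. -/
def StableSeq {K H : Type*} [Group K] [Group H] (h : ℕ → (K →* H)) : Prop :=
  ∀ k : K, (∀ᶠ n in Filter.atTop, h n k = 1) ∨ (∀ᶠ n in Filter.atTop, h n k ≠ 1)

/-- A sequence of homomorphisms has trivial stable kernel. -/
def TrivialStableKernel {K H : Type*} [Group K] [Group H] (h : ℕ → (K →* H)) : Prop :=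
  ∀ k : K, (∀ᶠ n in Filter.atTop, h n k = 1) → k = 1

/-- A stable sequence of homomorphisms `g n : D → H` with trivial stable kernel strongly
converges to `D`, where `D` is a subgroup of an extension of the base group `H`, the base
group being embedded via `e`. -/
def StronglyConverges {H Gs : Type*} [Group H] [Group Gs] (e : H →* Gs)
    (D : Subgroup Gs) (g : ℕ → (↥D →* H)) : Prop :=
  StableSeq g ∧ TrivialStableKernel g ∧
  (∀ (d : ↥D) (b : H), (d : Gs) = e b → ∀ᶠ n in Filter.atTop, g n d = b) ∧
  (∀ (d : ↥D) (b : H), (∃ᶠ n in Filter.atTop, g n d = b) → (d : Gs) = e b)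

/-- The ball of radius `r` about the identity in the word metric w.r.t. `S`. -/
def wordBall (S : Set G) (r : ℕ) : Set G :=
  {g | ∃ l : List G, l.length ≤ r ∧ (∀ x ∈ l, x ∈ S ∨ x⁻¹ ∈ S) ∧ l.prod = g}

end GroupDefs

namespace HNNCounterexample

variable (A₀ : Type)

/-- The free group with basis `A₀ ∪ {a, b, u, y}`. -/
abbrev Base := FreeGroup (A₀ ⊕ Fin 4)

/-- The generator `a`. -/
def a : Base A₀ := FreeGroup.of (Sum.inr 0)

/-- The generator `b`. -/
def b : Base A₀ := FreeGroup.of (Sum.inr 1)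

/-- The generator `u`. -/
def u : Base A₀ := FreeGroup.of (Sum.inr 2)

/-- The generator `y`. -/
def y : Base A₀ := FreeGroup.of (Sum.inr 3)

/-- The element `v = a y b y a y⁻¹ b y⁻¹`. -/
def v : Base A₀ := a A₀ * y A₀ * b A₀ * y A₀ * a A₀ * (y A₀)⁻¹ * b A₀ * (y A₀)⁻¹

/-- The subgroup `A = ⟨A₀, a, b, u⟩` of `H`. -/
def A : Subgroup (Base A₀) :=
  Subgroup.closure ((Set.range fun x : A₀ => FreeGroup.of (Sum.inl x)) ∪ {a A₀, b A₀, u A₀})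

/-- The HNN extension `F = ⟨H, t | u^t = v⟩` of `H` along the isomorphism
`⟨u⟩ → ⟨v⟩`, `u ↦ v` (the latter isomorphism being given as `φ`). -/
abbrev Ext (φ : ↥(Subgroup.zpowers (u A₀)) ≃* ↥(Subgroup.zpowers (v A₀))) :=
  HNNExtension (Base A₀) (Subgroup.zpowers (u A₀)) (Subgroup.zpowers (v A₀)) φ

/-- The canonical embedding of `H` into `F`. -/
def ofH (φ : ↥(Subgroup.zpowers (u A₀)) ≃* ↥(Subgroup.zpowers (v A₀))) :
    Base A₀ →* Ext A₀ φ :=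
  HNNExtension.of

end HNNCounterexample

namespace FreeGroup

open List

variable {α : Type*}

theorem IsReduced.invRev {L : List (α × Bool)} (h : IsReduced L) :
    IsReduced (FreeGroup.invRev L) := by
  classical
  rw [isReduced_iff_reduce_eq, reduce_invRev, h.reduce_eq]

theorem IsReduced.eq_of_mk_eq {L₁ L₂ : List (α × Bool)} (h₁ : IsReduced L₁) (h₂ : IsReduced L₂)
    (h : mk L₁ = mk L₂) : L₁ = L₂ := by
  classical
  rw [← h₁.reduce_eq, ← h₂.reduce_eq, ← toWord_mk, ← toWord_mk, h]

theorem IsReduced.append {L₁ L₂ : List (α × Bool)} (h₁ : IsReduced L₁) (h₂ : IsReduced L₂)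
    (h : ∀ a ∈ L₁.getLast?, ∀ b ∈ L₂.head?, a.1 = b.1 → a.2 = b.2) : IsReduced (L₁ ++ L₂) :=
  IsChain.append h₁ h₂ h

theorem IsCyclicallyReduced.append_comm {L₁ L₂ : List (α × Bool)}
    (h : IsCyclicallyReduced (L₁ ++ L₂)) : IsCyclicallyReduced (L₂ ++ L₁) := by
  rcases eq_or_ne L₁ [] with rfl | h₁
  · simpa using h
  rcases eq_or_ne L₂ [] with rfl | h₂
  · simpa using h
  obtain ⟨hr, hc⟩ := h
  have hr' := isChain_append.1 hr
  refine ⟨hr'.2.1.append hr'.1 fun x hx z hz => hc x ?_ z ?_, fun x hx z hz => hr'.2.2 x ?_ z ?_⟩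
  · rwa [getLast?_append_of_ne_nil _ h₂]
  · rwa [head?_append_of_ne_nil _ h₁]
  · rwa [getLast?_append_of_ne_nil _ h₁] at hx
  · rwa [head?_append_of_ne_nil _ h₂] at hz

theorem IsCyclicallyReduced.of_isRotated {L₁ L₂ : List (α × Bool)} (h : IsCyclicallyReduced L₁)
    (hr : L₁ ~r L₂) : IsCyclicallyReduced L₂ := by
  obtain ⟨n, hn, rfl⟩ := isRotated_iff_mod.1 hr
  rw [rotate_eq_drop_append_take hn]
  exact IsCyclicallyReduced.append_comm (by rwa [take_append_drop])

/-- Conjugate cyclically reduced words are rotations of each other, and a conjugating element is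
a product of the letters involved. -/
theorem IsCyclicallyReduced.isRotated_of_conj {w₁ w₂ : List (α × Bool)}
    (h₁ : IsCyclicallyReduced w₁) (h₂ : IsCyclicallyReduced w₂) (hne : w₁ ≠ []) {x : FreeGroup α}
    (h : x * mk w₁ * x⁻¹ = mk w₂) :
    w₁ ~r w₂ ∧ x ∈ Subgroup.closure ((fun l : α × Bool => of l.1) '' {l | l ∈ w₁}) := by
  classical
  have letter_mem : ∀ (w : List (α × Bool)) (c : α) (i : Bool), (∃ j, (c, j) ∈ w) →
      mk [(c, i)] ∈ Subgroup.closure ((fun l : α × Bool => of l.1) '' {l | l ∈ w}) := by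
    rintro w c i ⟨j, hj⟩
    have : of c ∈ Subgroup.closure ((fun l : α × Bool => of l.1) '' {l | l ∈ w}) :=
      Subgroup.subset_closure ⟨(c, j), hj, rfl⟩
    cases i
    · exact inv_mem this
    · exact this
  obtain ⟨X, hX, rfl⟩ : ∃ X, IsReduced X ∧ mk X = x := ⟨x.toWord, isReduced_toWord, mk_toWord⟩
  induction X using List.reverseRecOn generalizing w₁ with
  | nil =>
    have := h₁.isReduced.eq_of_mk_eq h₂.isReduced (by simpa [← one_eq_mk] using h)
    exact ⟨this ▸ IsRotated.refl _, one_mem _⟩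
  | append_singleton X c ih =>
    obtain ⟨c, i⟩ := c
    have hX' : IsReduced X := hX.infix ⟨[], [(c, i)], by simp⟩
    have key : ∀ w, w ~r w₁ → (∃ j, (c, j) ∈ w₁) →
        mk w = mk [(c, i)] * mk w₁ * (mk [(c, i)])⁻¹ →
        w₁ ~r w₂ ∧ mk (X ++ [(c, i)]) ∈
          Subgroup.closure ((fun l : α × Bool => of l.1) '' {l | l ∈ w₁}) := by
      intro w hw hm hmk
      have hw0 : w ≠ [] := by
        rintro rfl
        exact hne (by simpa using hw.symm)
      obtain ⟨hr, hc⟩ := ih (h₁.of_isRotated hw.symm) hw0 hX' (by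
        rw [hmk, ← h, ← mul_mk]; group)
      refine ⟨hw.symm.trans hr, ?_⟩
      have hs : {l | l ∈ w} = {l | l ∈ w₁} := by
        ext l; exact hw.mem_iff
      rw [hs] at hc
      rw [← mul_mk]
      exact mul_mem hc (letter_mem _ _ _ hm)
    by_cases hhead : (c, !i) ∈ w₁.head?
    · obtain ⟨w, rfl⟩ : ∃ w, w₁ = (c, !i) :: w := by
        cases w₁ <;> simp_all
      refine key (w ++ [(c, !i)]) (isRotated_concat _ _) ⟨!i, by simp⟩ ?_
      rw [inv_mk, mul_mk, mul_mk]
      symm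
      exact Quot.sound (by simp [FreeGroup.invRev])
    by_cases hlast : (c, i) ∈ w₁.getLast?
    · obtain ⟨w, rfl⟩ : ∃ w, w₁ = w ++ [(c, i)] := by
        rcases eq_nil_or_concat w₁ with rfl | ⟨w, d, rfl⟩ <;> simp_all
      refine key ((c, i) :: w) (isRotated_concat _ _).symm ⟨i, by simp⟩ ?_
      rw [inv_mk, mul_mk, mul_mk]
      symm
      have := (Red.Step.not (L₁ := (c, i) :: w) (L₂ := []) (x := c) (b := i))
      exact Quot.sound (by simpa [FreeGroup.invRev] using this)
    · exfalso
      have r₁ : IsReduced ((X ++ [(c, i)]) ++ w₁) := by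
        refine hX.append h₁.isReduced ?_
        rintro a ha ⟨d, j⟩ hb hab
        simp only [getLast?_append, getLast?_singleton, Option.some_or, Option.mem_some_iff] at ha
        subst ha
        by_contra hij
        apply hhead
        have : j = !i := by revert hij; cases i <;> cases j <;> simp
        simp only at hab
        rw [hab, ← this]; exact hb
      have r₂ : IsReduced (w₁ ++ FreeGroup.invRev (X ++ [(c, i)])) := by
        refine h₁.isReduced.append hX.invRev ?_
        rintro ⟨d, j⟩ ha b hb hab
        obtain rfl : (c, !i) = b := by simpa [FreeGroup.invRev] using hb
        by_contra hij
        apply hlast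
        have : j = i := by revert hij; cases i <;> cases j <;> simp
        simp only at hab
        rw [← hab, ← this]; exact ha
      have r₃ := r₁.append_overlap r₂ hne
      have e := r₃.eq_of_mk_eq h₂.isReduced (by rw [← h, inv_mk, mul_mk, mul_mk])
      rw [← e] at h₂
      obtain ⟨d, Y, hdY⟩ : ∃ d Y, X ++ [(c, i)] = d :: Y := by
        cases X <;> simp
      have := h₂.2 (d.1, !d.2)
        (by rw [hdY, invRev_cons, ← append_assoc, getLast?_append]; simp [FreeGroup.invRev]) d
        (by simp [hdY]) rfl
      simp at this

variable {p : α → Prop}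

/-- A nonempty reduced word whose letters all satisfy `p`. -/
def IsInnerWord (p : α → Prop) (m : List (α × Bool)) : Prop :=
  IsReduced m ∧ m ≠ [] ∧ ∀ l ∈ m, p l.1

/-- A nonempty reduced word whose first and last letters do not satisfy `p`. -/
def IsOuterWord (p : α → Prop) (Z : List (α × Bool)) : Prop :=
  IsReduced Z ∧ Z ≠ [] ∧ (∀ l ∈ Z.head?, ¬ p l.1) ∧ ∀ l ∈ Z.getLast?, ¬ p l.1

theorem IsOuterWord.invRev {Z : List (α × Bool)} (h : IsOuterWord p Z) :
    IsOuterWord p (FreeGroup.invRev Z) := by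
  refine ⟨h.1.invRev, by simpa [FreeGroup.invRev] using h.2.1, fun l hl => ?_, fun l hl => ?_⟩
  · simp only [FreeGroup.invRev, head?_reverse, getLast?_map, Option.mem_def,
      Option.map_eq_some_iff] at hl
    obtain ⟨l', hl', rfl⟩ := hl
    exact h.2.2.2 l' hl'
  · simp only [FreeGroup.invRev, getLast?_reverse, head?_map, Option.mem_def,
      Option.map_eq_some_iff] at hl
    obtain ⟨l', hl', rfl⟩ := hl
    exact h.2.2.1 l' hl'

theorem IsOuterWord.append_inner {Z m : List (α × Bool)} (hZ : IsOuterWord p Z)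
    (hm : IsInnerWord p m) : IsReduced (Z ++ m) :=
  hZ.1.append hm.1 fun l hl k hk e =>
    absurd (e ▸ hm.2.2 k (mem_of_mem_head? hk)) (hZ.2.2.2 l hl)

theorem IsInnerWord.append_outer {Z m : List (α × Bool)} (hm : IsInnerWord p m)
    (hZ : IsOuterWord p Z) : IsReduced (m ++ Z) :=
  hm.1.append hZ.1 fun l hl k hk e =>
    absurd (e ▸ hm.2.2 l (mem_of_mem_getLast? hl)) (hZ.2.2.1 k hk)

theorem IsOuterWord.glue {Z₁ Z₂ m : List (α × Bool)} (h₁ : IsOuterWord p Z₁)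
    (hm : IsInnerWord p m) (h₂ : IsOuterWord p Z₂) : IsOuterWord p (Z₁ ++ m ++ Z₂) := by
  refine ⟨(h₁.append_inner hm).append_overlap (hm.append_outer h₂) hm.2.1, by simp [hm.2.1],
    fun l hl => ?_, fun l hl => ?_⟩
  · rw [append_assoc, head?_append_of_ne_nil _ h₁.2.1] at hl
    exact h₁.2.2.1 l hl
  · rw [getLast?_append_of_ne_nil _ h₂.2.1] at hl
    exact h₂.2.2.2 l hl

theorem IsOuterWord.isCyclicallyReduced_append {Z m : List (α × Bool)} (hZ : IsOuterWord p Z)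
    (hm : IsInnerWord p m) : IsCyclicallyReduced (Z ++ m) := by
  refine ⟨hZ.append_inner hm, fun l hl k hk e => ?_⟩
  rw [getLast?_append_of_ne_nil _ hm.2.1] at hl
  rw [head?_append_of_ne_nil _ hZ.2.1] at hk
  exact absurd (e ▸ hm.2.2 l (mem_of_mem_getLast? hl)) (hZ.2.2.1 k hk)

theorem isInnerWord_reduce [DecidableEq α] {L : List (α × Bool)} (hL : ∀ l ∈ L, p l.1)
    (h : mk L ≠ 1) : IsInnerWord p (reduce L) :=
  ⟨isReduced_iff_reduce_eq.2 reduce.idem, fun e => h (by rw [← toWord_eq_nil_iff, toWord_mk, e]),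
    fun l hl => hL l (reduce.red.sublist.subset hl)⟩

theorem IsOuterWord.reduce_append_self [DecidableEq α] {Z : List (α × Bool)}
    (h : IsOuterWord p Z) : IsOuterWord p (reduce (Z ++ Z)) ∧ 2 ≤ (reduce (Z ++ Z)).length := by
  have e := reduceCyclically.reduce_flatten_replicate_succ h.1 1
  have hc := reduceCyclically.conj_conjugator_reduceCyclically Z
  set c := reduceCyclically.conjugator Z
  set d := reduceCyclically Z
  simp only [replicate, flatten_cons, flatten_nil, append_nil] at e
  have hd : d ≠ [] := by
    intro hd
    have h1 : mk Z = 1 := by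
      rw [← hc, hd, append_nil, ← mul_mk, ← inv_mk, mul_inv_cancel]
    exact h.2.1 (h.1.eq_of_mk_eq IsReduced.nil h1)
  rw [e]
  refine ⟨⟨e ▸ isReduced_iff_reduce_eq.2 reduce.idem, by simp [hd], fun l hl => h.2.2.1 l ?_,
    fun l hl => h.2.2.2 l ?_⟩, ?_⟩
  · rw [← hc]
    rcases eq_or_ne c [] with h0 | h0
    · rw [h0] at hl ⊢
      simpa [head?_append_of_ne_nil _ hd] using hl
    · rw [append_assoc, head?_append_of_ne_nil _ h0] at hl ⊢
      exact hl
  · rw [← hc]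
    rcases eq_or_ne c [] with h0 | h0
    · rw [h0] at hl ⊢
      simpa [getLast?_append_of_ne_nil _ hd] using hl
    · have h0' : FreeGroup.invRev c ≠ [] := by simpa [FreeGroup.invRev] using h0
      rw [getLast?_append_of_ne_nil _ h0'] at hl ⊢
      exact hl
  · have := length_pos_iff.2 hd
    simp only [length_append]
    omega

theorem _root_.List.exists_eq_append_cons_of_not_forall {β : Type*} {q : β → Prop} {L : List β}
    (h : ¬ ∀ l ∈ L, q l) : ∃ P l D, L = P ++ l :: D ∧ (∀ k ∈ P, q k) ∧ ¬ q l := by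
  induction L with
  | nil => simp at h
  | cons l L ih =>
    by_cases hl : q l
    · obtain ⟨P, k, D, rfl, hP, hk⟩ := ih fun H => h (by simpa [hl] using H)
      exact ⟨l :: P, k, D, rfl, by simpa [hl] using hP, hk⟩
    · exact ⟨[], l, L, rfl, by simp, hl⟩

theorem IsReduced.exists_outer {L : List (α × Bool)} (hL : IsReduced L)
    (h : ¬ ∀ l ∈ L, p l.1) : ∃ P Z Q, L = P ++ Z ++ Q ∧ (∀ l ∈ P, p l.1) ∧ (∀ l ∈ Q, p l.1) ∧
      IsOuterWord p Z := by
  obtain ⟨P, l, D, rfl, hP, hl⟩ := exists_eq_append_cons_of_not_forall h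
  obtain ⟨Q, k, E, hQE, hQ, hk⟩ := exists_eq_append_cons_of_not_forall (L := (l :: D).reverse)
    (q := fun l => p l.1) (fun H => hl (H l (by simp)))
  have e : l :: D = (E.reverse ++ [k]) ++ Q.reverse := by
    rw [← reverse_reverse (l :: D), hQE]; simp
  refine ⟨P, E.reverse ++ [k], Q.reverse, by rw [e]; simp, hP, by simpa using hQ,
    hL.infix ⟨P, Q.reverse, by rw [e]; simp⟩, by simp, fun x hx => ?_, by simpa using hk⟩
  have : x ∈ (l :: D).head? := by
    rw [e, head?_append_of_ne_nil _ (by simp)]; exact hx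
  obtain rfl : l = x := by simpa using this
  exact hl

end FreeGroup

namespace HNNCounterexample

open FreeGroup hiding map_mul map_inv map_one
open List

variable {A₀ : Type}

/-- The product `a Y b Y a Y⁻¹ b Y⁻¹`. -/
def word (Y : Base A₀) : Base A₀ := a A₀ * Y * b A₀ * Y * a A₀ * Y⁻¹ * b A₀ * Y⁻¹

/-- The letters `a` and `b`. -/
def IsAB (c : A₀ ⊕ Fin 4) : Prop := c = Sum.inr 0 ∨ c = Sum.inr 1

variable (A₀) in
/-- The cyclically reduced word `y b y a y⁻¹ b y⁻¹ a`. -/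
def core : List ((A₀ ⊕ Fin 4) × Bool) :=
  [(Sum.inr 3, true), (Sum.inr 1, true), (Sum.inr 3, true), (Sum.inr 0, true),
    (Sum.inr 3, false), (Sum.inr 1, true), (Sum.inr 3, false), (Sum.inr 0, true)]

theorem mk_core : mk (core A₀) = (a A₀)⁻¹ * v A₀ * a A₀ := by
  have : mk (core A₀) = y A₀ * b A₀ * y A₀ * a A₀ * (y A₀)⁻¹ * b A₀ * (y A₀)⁻¹ * a A₀ := rfl
  rw [this, v]
  group

theorem isCyclicallyReduced_core : IsCyclicallyReduced (core A₀) := by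
  simp [core, IsCyclicallyReduced, FreeGroup.IsReduced]

theorem isRotated_core {Y g x : Base A₀} {W : List ((A₀ ⊕ Fin 4) × Bool)}
    (hW : IsCyclicallyReduced W) (hne : W ≠ []) (hmk : mk W = g⁻¹ * word Y * g)
    (hx : x * word Y * x⁻¹ = v A₀) : core A₀ ~r W := by
  refine (hW.isRotated_of_conj isCyclicallyReduced_core hne (x := (a A₀)⁻¹ * x * g) ?_).1.symm
  rw [mk_core, hmk, ← hx]
  group

theorem word_inv (Y : Base A₀) :
    (a A₀ * Y * b A₀ * Y) * word Y⁻¹ * (a A₀ * Y * b A₀ * Y)⁻¹ = word Y := by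
  simp only [word]
  group

theorem commute_of_mem_zpowers {c : A₀ ⊕ Fin 4} {x : Base A₀} (h : x * of c * x⁻¹ = of c) :
    ∃ n : ℤ, x = of c ^ n := by
  have hc : IsCyclicallyReduced [(c, true)] := IsCyclicallyReduced.singleton
  have := (hc.isRotated_of_conj hc (by simp) (x := x) h).2
  simp only [List.mem_singleton, Set.ofPred_eq_eq_singleton, Set.image_singleton,
    ← Subgroup.zpowers_eq_closure] at this
  obtain ⟨n, hn⟩ := this
  exact ⟨n, hn.symm⟩

/-- The exponent sum of the letter `c`. -/
noncomputable def expSum (c : A₀ ⊕ Fin 4) : Base A₀ →* Multiplicative ℤ :=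
  open Classical in
  FreeGroup.lift fun d => if d = c then Multiplicative.ofAdd 1 else 1

theorem expSum_conj_b_mul_b (x : Base A₀) :
    expSum (Sum.inr 1) (x⁻¹ * (b A₀ * b A₀) * x) = Multiplicative.ofAdd 2 := by
  have h : expSum (Sum.inr 1) (b A₀) = Multiplicative.ofAdd 1 := by simp [expSum, b]
  rw [map_mul, map_mul, map_inv, map_mul, h, mul_right_comm, inv_mul_cancel, one_mul]
  rfl

theorem eq_one_of_conj_eq {q p : Base A₀} (hq : q * a A₀ * q⁻¹ = a A₀)
    (hp : p⁻¹ * a A₀ * p = a A₀) (hb : q * b A₀ * p = b A₀) : p = 1 ∧ q = 1 := by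
  obtain ⟨n, hn⟩ := commute_of_mem_zpowers hq
  obtain ⟨m, hm⟩ := commute_of_mem_zpowers (c := Sum.inr 0) (x := p⁻¹)
    (by rw [inv_inv]; exact hp)
  have hq' : q * b A₀ * q⁻¹ = b A₀ := by
    have h0 := congrArg (expSum (Sum.inr 0)) hb
    have hmn : m = n := by
      rw [← inv_inv p, hm, hn] at h0
      simp [expSum, b, ← ofAdd_zsmul, ← ofAdd_neg, ← ofAdd_add] at h0
      omega
    have hpq : p = q⁻¹ := by rw [← inv_inv p, hm, hmn, hn]
    rwa [hpq] at hb
  obtain ⟨k, hk⟩ := commute_of_mem_zpowers hq'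
  have h0 : n = 0 := by
    have := congrArg (expSum (Sum.inr 0)) (hn.symm.trans hk)
    simpa [expSum, ← ofAdd_zsmul] using this
  have hq1 : q = 1 := by rw [hn, h0, zpow_zero]
  subst hq1
  refine ⟨?_, rfl⟩
  simpa using hb

/-- The homomorphism to `S₃` sending `a` and `b` to `(0 1)`, `y` to `s` and the other letters
to `1`. -/
def toPerm (s : Equiv.Perm (Fin 3)) : Base A₀ →* Equiv.Perm (Fin 3) :=
  FreeGroup.lift (Sum.elim 1 ![Equiv.swap 0 1, Equiv.swap 0 1, 1, s])

theorem toPerm_a (s : Equiv.Perm (Fin 3)) : toPerm s (a A₀) = Equiv.swap 0 1 :=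
  FreeGroup.lift_apply_of

theorem toPerm_b (s : Equiv.Perm (Fin 3)) : toPerm s (b A₀) = Equiv.swap 0 1 :=
  FreeGroup.lift_apply_of

theorem toPerm_y (s : Equiv.Perm (Fin 3)) : toPerm s (y A₀) = s :=
  FreeGroup.lift_apply_of

theorem word_ne_of_letters {L : List ((A₀ ⊕ Fin 4) × Bool)} (hL : ∀ l ∈ L, IsAB l.1)
    (x : Base A₀) : x * word (mk L) * x⁻¹ ≠ v A₀ := by
  intro h
  have hρ : ∀ s, toPerm s (mk L) = toPerm 1 (mk L) := by
    intro s
    simp only [toPerm, FreeGroup.lift_mk]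
    congr 1
    refine List.map_congr_left fun l hl => ?_
    rcases hL l hl with e | e <;> rw [e] <;> rfl
  have h1 : toPerm 1 (word (mk L)) = 1 := by
    have : toPerm 1 (v A₀) = 1 := by
      simp only [v, map_mul, map_inv, toPerm_a, toPerm_b, toPerm_y]
      decide
    rw [← h, map_mul, map_mul, map_inv] at this
    simpa using this
  have h2 : toPerm (Equiv.swap 1 2) (word (mk L)) = 1 := by
    rw [← h1]
    simp only [word, map_mul, map_inv, hρ, toPerm_a, toPerm_b]
  have h3 : toPerm (Equiv.swap 1 2) (v A₀) ≠ 1 := by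
    simp only [v, map_mul, map_inv, toPerm_a, toPerm_b, toPerm_y]
    decide
  apply h3
  rw [← h, map_mul, map_mul, map_inv, h2, mul_one, mul_inv_cancel]

theorem isRotated_core_cases {W : List ((A₀ ⊕ Fin 4) × Bool)} (h : core A₀ ~r W) :
    ∃ n < 8, (core A₀).rotate n = W := by
  obtain ⟨n, rfl⟩ := h
  exact ⟨n % 8, Nat.mod_lt _ (by norm_num), rotate_mod (core A₀) n⟩

section blocks

variable {P Z Q : List ((A₀ ⊕ Fin 4) × Bool)}

theorem length_eq_one_cases {β : Type*} {l : List β} (h : l ≠ []) (h' : l.length ≤ 1) :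
    ∃ c, l = [c] := length_eq_one_iff.1 (le_antisymm h' (length_pos_iff.2 h))

theorem ne_one_of_letters {L : List ((A₀ ⊕ Fin 4) × Bool)} {x : Base A₀} {c : A₀ ⊕ Fin 4}
    (h : mk L = x * of c * x⁻¹) : mk L ≠ 1 := by
  rw [h]
  simp [FreeGroup.of_ne_one]

theorem letters_invRev (hP : ∀ l ∈ P, IsAB l.1) : ∀ l ∈ FreeGroup.invRev P, IsAB l.1 := by
  intro l hl
  simp only [FreeGroup.invRev, mem_reverse, List.mem_map] at hl
  obtain ⟨k, hk, rfl⟩ := hl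
  exact hP k hk

theorem middle_ne_one (hP : ∀ l ∈ P, IsAB l.1) (hQ : ∀ l ∈ Q, IsAB l.1)
    (hZ : IsOuterWord IsAB Z) {x : Base A₀}
    (hx : x * word (mk P * mk Z * mk Q) * x⁻¹ = v A₀) : mk Q * b A₀ * mk P ≠ 1 := by
  classical
  intro h1
  have hQP : (mk Q)⁻¹ = b A₀ * mk P := by
    rw [inv_eq_iff_mul_eq_one, ← mul_assoc, h1]
  have hQ' : mk Q = (b A₀ * mk P)⁻¹ := by rw [← hQP, inv_inv]
  let L₂ := Q ++ [(Sum.inr 0, true)] ++ FreeGroup.invRev Q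
  let L₃ := FreeGroup.invRev P ++ [(Sum.inr 1, true), (Sum.inr 1, true)] ++ P
  let L₄ := FreeGroup.invRev P ++ [(Sum.inr 0, true)] ++ P
  have e₂ : mk L₂ = mk Q * a A₀ * (mk Q)⁻¹ := rfl
  have e₃ : mk L₃ = (mk P)⁻¹ * (b A₀ * b A₀) * mk P := rfl
  have e₄ : mk L₄ = (mk P)⁻¹ * a A₀ * mk P := rfl
  have i₂ : IsInnerWord IsAB (reduce L₂) := by
    refine isInnerWord_reduce (fun l hl => ?_) (ne_one_of_letters e₂)
    simp only [L₂, mem_append, mem_singleton] at hl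
    rcases hl with (hl | rfl) | hl
    exacts [hQ l hl, Or.inl rfl, letters_invRev hQ l hl]
  have hlen₃ : ∀ c, mk L₃ ≠ mk [c] := by
    rintro ⟨c, i⟩ hc
    have := congrArg (expSum (Sum.inr 1)) (e₃.symm.trans hc)
    rw [expSum_conj_b_mul_b, expSum, FreeGroup.lift_mk] at this
    by_cases hc' : c = Sum.inr 1 <;> cases i <;> simp [hc'] at this
    exact absurd this (by decide)
  have i₃ : IsInnerWord IsAB (reduce L₃) := by
    refine isInnerWord_reduce (fun l hl => ?_) fun h => ?_
    · simp only [L₃, mem_append, mem_cons, not_mem_nil, or_false, or_self] at hl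
      rcases hl with (hl | rfl) | hl
      exacts [letters_invRev hP l hl, Or.inr rfl, hP l hl]
    · have := congrArg (expSum (Sum.inr 1)) (e₃.symm.trans h)
      rw [expSum_conj_b_mul_b, map_one] at this
      exact absurd this (by decide)
  have i₄ : IsInnerWord IsAB (reduce L₄) := by
    refine isInnerWord_reduce (fun l hl => ?_)
      (ne_one_of_letters (x := (mk P)⁻¹) (c := Sum.inr 0) (by rw [e₄, inv_inv]; rfl))
    simp only [L₄, mem_append, mem_singleton] at hl
    rcases hl with (hl | rfl) | hl
    exacts [letters_invRev hP l hl, Or.inl rfl, hP l hl]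
  obtain ⟨hR, hRlen⟩ := hZ.reduce_append_self
  have hcyc := ((hR.glue i₂ hZ.invRev).glue i₃ hZ.invRev).isCyclicallyReduced_append i₄
  have hrot := isRotated_core (g := a A₀ * mk P) hcyc (by simp [i₄.2.1]) (by
    simp only [← mul_mk, reduce.self, e₂, e₃, e₄, ← inv_mk, word, mul_inv_rev, hQP]
    rw [hQ']
    group) hx
  have hlen := hrot.perm.length_eq
  have l₂ := length_pos_iff.2 i₂.2.1
  have l₄ := length_pos_iff.2 i₄.2.1
  have lZ := length_pos_iff.2 hZ.2.1
  have l₃ : 2 ≤ (reduce L₃).length := by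
    by_contra hlt
    obtain ⟨c, hc⟩ := length_eq_one_cases i₃.2.1 (by omega)
    exact hlen₃ c (by rw [← hc, reduce.self])
  simp only [length_append, invRev_length, core, length_cons, length_nil] at hlen
  obtain ⟨z, rfl⟩ := length_eq_one_cases hZ.2.1 (by omega)
  obtain ⟨c₂, h₂⟩ := length_eq_one_cases i₂.2.1 (by omega)
  obtain ⟨c₄, h₄⟩ := length_eq_one_cases i₄.2.1 (by omega)
  obtain ⟨d₁, d₂, h₃⟩ := length_eq_two.1 (show (reduce L₃).length = 2 by
    simp only [length_singleton] at hlen; omega)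
  obtain ⟨r₁, r₂, hr⟩ := length_eq_two.1 (show (reduce ([z] ++ [z])).length = 2 by
    simp only [length_singleton] at hlen; omega)
  rw [h₂, h₃, h₄, hr] at hrot
  have p₁ : IsAB d₁.1 := i₃.2.2 d₁ (by simp [h₃])
  have p₂ : IsAB d₂.1 := i₃.2.2 d₂ (by simp [h₃])
  obtain ⟨n, hn, hrot⟩ := isRotated_core_cases hrot
  interval_cases n <;>
    simp only [core, FreeGroup.invRev, rotate_cons_succ, rotate_zero, map_cons, map_nil,
      reverse_cons, reverse_nil, nil_append, cons_append, cons.injEq, and_true] at hrot <;>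
    obtain ⟨rfl, rfl, rfl, hz, rfl, rfl, hz', rfl⟩ := hrot <;>
    simp [IsAB] at p₁ p₂

theorem eq_of_middle_ne_one (hP : ∀ l ∈ P, IsAB l.1) (hQ : ∀ l ∈ Q, IsAB l.1)
    (hZ : IsOuterWord IsAB Z) {x : Base A₀}
    (hx : x * word (mk P * mk Z * mk Q) * x⁻¹ = v A₀) (h₁ : mk Q * b A₀ * mk P ≠ 1)
    (h₃ : (mk P)⁻¹ * b A₀ * (mk Q)⁻¹ ≠ 1) :
    mk P * mk Z * mk Q = y A₀ ∨ mk P * mk Z * mk Q = (y A₀)⁻¹ := by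
  classical
  let L₁ := Q ++ [(Sum.inr 1, true)] ++ P
  let L₂ := Q ++ [(Sum.inr 0, true)] ++ FreeGroup.invRev Q
  let L₃ := FreeGroup.invRev P ++ [(Sum.inr 1, true)] ++ FreeGroup.invRev Q
  let L₄ := FreeGroup.invRev P ++ [(Sum.inr 0, true)] ++ P
  have e₁ : mk L₁ = mk Q * b A₀ * mk P := rfl
  have e₂ : mk L₂ = mk Q * a A₀ * (mk Q)⁻¹ := rfl
  have e₃ : mk L₃ = (mk P)⁻¹ * b A₀ * (mk Q)⁻¹ := rfl
  have e₄ : mk L₄ = (mk P)⁻¹ * a A₀ * mk P := rfl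
  have i₁ : IsInnerWord IsAB (reduce L₁) := by
    refine isInnerWord_reduce (fun l hl => ?_) h₁
    simp only [L₁, mem_append, mem_singleton] at hl
    rcases hl with (hl | rfl) | hl
    exacts [hQ l hl, Or.inr rfl, hP l hl]
  have i₂ : IsInnerWord IsAB (reduce L₂) := by
    refine isInnerWord_reduce (fun l hl => ?_) (ne_one_of_letters e₂)
    simp only [L₂, mem_append, mem_singleton] at hl
    rcases hl with (hl | rfl) | hl
    exacts [hQ l hl, Or.inl rfl, letters_invRev hQ l hl]
  have i₃ : IsInnerWord IsAB (reduce L₃) := by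
    refine isInnerWord_reduce (fun l hl => ?_) h₃
    simp only [L₃, mem_append, mem_singleton] at hl
    rcases hl with (hl | rfl) | hl
    exacts [letters_invRev hP l hl, Or.inr rfl, letters_invRev hQ l hl]
  have i₄ : IsInnerWord IsAB (reduce L₄) := by
    refine isInnerWord_reduce (fun l hl => ?_)
      (ne_one_of_letters (x := (mk P)⁻¹) (c := Sum.inr 0) (by rw [e₄, inv_inv]; rfl))
    simp only [L₄, mem_append, mem_singleton] at hl
    rcases hl with (hl | rfl) | hl
    exacts [letters_invRev hP l hl, Or.inl rfl, hP l hl]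
  have hcyc := (((hZ.glue i₁ hZ).glue i₂ hZ.invRev).glue i₃ hZ.invRev).isCyclicallyReduced_append i₄
  have hrot := isRotated_core (g := a A₀ * mk P) hcyc (by simp [i₄.2.1]) (by
    simp only [← mul_mk, reduce.self, e₁, e₂, e₃, e₄, ← inv_mk, word, mul_inv_rev]
    group) hx
  have hlen := hrot.perm.length_eq
  have l₁ := length_pos_iff.2 i₁.2.1
  have l₂ := length_pos_iff.2 i₂.2.1
  have l₃ := length_pos_iff.2 i₃.2.1
  have l₄ := length_pos_iff.2 i₄.2.1
  have lZ := length_pos_iff.2 hZ.2.1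
  simp only [length_append, invRev_length, core, length_cons, length_nil] at hlen
  obtain ⟨z, rfl⟩ := length_eq_one_cases hZ.2.1 (by omega)
  obtain ⟨c₁, k₁⟩ := length_eq_one_cases i₁.2.1 (by omega)
  obtain ⟨c₂, k₂⟩ := length_eq_one_cases i₂.2.1 (by omega)
  obtain ⟨c₃, k₃⟩ := length_eq_one_cases i₃.2.1 (by omega)
  obtain ⟨c₄, k₄⟩ := length_eq_one_cases i₄.2.1 (by omega)
  rw [k₁, k₂, k₃, k₄] at hrot
  have pz : ¬ IsAB z.1 := hZ.2.2.1 z (by simp)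
  have main : (z = (Sum.inr 3, true) ∨ z = (Sum.inr 3, false)) ∧ c₁ = (Sum.inr 1, true) ∧
      c₂ = (Sum.inr 0, true) ∧ c₄ = (Sum.inr 0, true) := by
    obtain ⟨n, hn, hrot⟩ := isRotated_core_cases hrot
    obtain ⟨z, i⟩ := z
    interval_cases n <;>
      simp only [core, FreeGroup.invRev, rotate_cons_succ, rotate_zero, map_cons, map_nil,
        reverse_cons, reverse_nil, nil_append, cons_append, cons.injEq, and_true,
        Prod.mk.injEq] at hrot <;>
      obtain ⟨⟨rfl, rfl⟩, rfl, hz, rfl, hz', rfl, hz'', rfl⟩ := hrot <;>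
      simp [IsAB] at *
  obtain ⟨hz, rfl, rfl, rfl⟩ := main
  have f₁ : mk Q * b A₀ * mk P = b A₀ := by rw [← e₁, ← reduce.self, k₁]; rfl
  have f₂ : mk Q * a A₀ * (mk Q)⁻¹ = a A₀ := by rw [← e₂, ← reduce.self, k₂]; rfl
  have f₄ : (mk P)⁻¹ * a A₀ * mk P = a A₀ := by rw [← e₄, ← reduce.self, k₄]; rfl
  obtain ⟨hP1, hQ1⟩ := eq_one_of_conj_eq f₂ f₄ f₁
  rw [hP1, hQ1, one_mul, mul_one]
  exact hz.imp (fun h => by rw [h]; rfl) (fun h => by rw [h]; rfl)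

end blocks

theorem eq_or_eq_inv_of_conj {Y x : Base A₀} (hx : x * word Y * x⁻¹ = v A₀) :
    Y = y A₀ ∨ Y = (y A₀)⁻¹ := by
  classical
  have hY : mk Y.toWord = Y := mk_toWord
  by_cases hL : ∀ l ∈ Y.toWord, IsAB l.1
  · refine absurd ?_ (word_ne_of_letters hL x)
    rwa [hY]
  obtain ⟨P, Z, Q, e, hP, hQ, hZ⟩ := isReduced_toWord.exists_outer hL
  have hY' : Y = mk P * mk Z * mk Q := by rw [← hY, e, mul_mk, mul_mk]
  rw [hY'] at hx ⊢
  refine eq_of_middle_ne_one hP hQ hZ hx (middle_ne_one hP hQ hZ hx) ?_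
  refine middle_ne_one (P := FreeGroup.invRev Q) (Q := FreeGroup.invRev P)
    (Z := FreeGroup.invRev Z) (letters_invRev hQ) (letters_invRev hP) hZ.invRev
    (x := x * (a A₀ * (mk P * mk Z * mk Q) * b A₀ * (mk P * mk Z * mk Q))) ?_
  rw [← hx, ← word_inv (mk P * mk Z * mk Q)]
  simp only [← inv_mk, mul_inv_rev, mul_assoc]

theorem bijective_of_fixes {f : Base A₀ →* Base A₀}
    (hA : ∀ c, f (of (Sum.inl c)) = of (Sum.inl c)) (ha : f (a A₀) = a A₀)
    (hb : f (b A₀) = b A₀) (hy : f (y A₀) = y A₀)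
    (hu : f ((u A₀)⁻¹ * v A₀ * u A₀) = (u A₀)⁻¹ * v A₀ * u A₀) : Function.Bijective f := by
  have hv : f (v A₀) = v A₀ := by simp only [v, map_mul, map_inv, ha, hb, hy]
  set c := f (u A₀) * (u A₀)⁻¹ with hc
  have hfu : f (u A₀) = c * u A₀ := by rw [hc, inv_mul_cancel_right]
  have hcomm : c * v A₀ * c⁻¹ = v A₀ := by
    rw [map_mul, map_mul, map_inv, hv, hfu] at hu
    have h2 : c⁻¹ * v A₀ * c = v A₀ := by
      have := congrArg (fun z => u A₀ * z * (u A₀)⁻¹) hu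
      simpa [mul_assoc] using this
    calc c * v A₀ * c⁻¹ = c * (c⁻¹ * v A₀ * c) * c⁻¹ := by rw [h2]
      _ = v A₀ := by group
  have hcmem : (a A₀)⁻¹ * c * a A₀ ∈ Subgroup.closure {a A₀, b A₀, y A₀} := by
    have := (isCyclicallyReduced_core.isRotated_of_conj isCyclicallyReduced_core (by simp [core])
      (x := (a A₀)⁻¹ * c * a A₀) (by
        rw [mk_core]
        calc _ = (a A₀)⁻¹ * (c * v A₀ * c⁻¹) * a A₀ := by group
          _ = _ := by rw [hcomm])).2
    refine Subgroup.closure_mono ?_ this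
    rintro _ ⟨l, hl, rfl⟩
    simp only [core, mem_cons, not_mem_nil, or_false, Set.mem_ofPred_eq] at hl
    rcases hl with rfl | rfl | rfl | rfl | rfl | rfl | rfl | rfl <;> simp [a, b, y]
  have hfix : ∀ (g : Base A₀ →* Base A₀), g (a A₀) = a A₀ → g (b A₀) = b A₀ → g (y A₀) = y A₀ →
      g c = c := by
    intro g ga gb gy
    have hle : Subgroup.closure {a A₀, b A₀, y A₀} ≤ g.eqLocus (MonoidHom.id _) := by
      rw [Subgroup.closure_le]
      rintro _ (rfl | rfl | rfl)
      exacts [ga, gb, gy]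
    have : g ((a A₀)⁻¹ * c * a A₀) = (a A₀)⁻¹ * c * a A₀ := hle hcmem
    simpa [ga] using this
  let g : Base A₀ →* Base A₀ :=
    FreeGroup.lift (Sum.elim (fun c => of (Sum.inl c)) ![a A₀, b A₀, c⁻¹ * u A₀, y A₀])
  have gA : ∀ c, g (of (Sum.inl c)) = of (Sum.inl c) := fun c => FreeGroup.lift_apply_of
  have ga : g (a A₀) = a A₀ := FreeGroup.lift_apply_of
  have gb : g (b A₀) = b A₀ := FreeGroup.lift_apply_of
  have gu : g (u A₀) = c⁻¹ * u A₀ := FreeGroup.lift_apply_of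
  have gy : g (y A₀) = y A₀ := FreeGroup.lift_apply_of
  have hfg : f.comp g = MonoidHom.id _ := by
    ext x
    rcases x with x | i
    · simp [gA, hA]
    · fin_cases i
      · change f (g (a A₀)) = a A₀
        rw [ga, ha]
      · change f (g (b A₀)) = b A₀
        rw [gb, hb]
      · change f (g (u A₀)) = u A₀
        rw [gu, map_mul, map_inv, hfix f ha hb hy, hfu, inv_mul_cancel_left]
      · change f (g (y A₀)) = y A₀
        rw [gy, hy]
  have hgf : g.comp f = MonoidHom.id _ := by
    ext x
    rcases x with x | i
    · simp [gA, hA]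
    · fin_cases i
      · change g (f (a A₀)) = a A₀
        rw [ha, ga]
      · change g (f (b A₀)) = b A₀
        rw [hb, gb]
      · change g (f (u A₀)) = u A₀
        rw [hfu, map_mul, hfix g ga gb gy, gu, mul_inv_cancel_left]
      · change g (f (y A₀)) = y A₀
        rw [hy, gy]
  exact Function.bijective_iff_has_inverse.2 ⟨g, DFunLike.congr_fun hgf, DFunLike.congr_fun hfg⟩

theorem bijective_and_eq_or_eq_inv {f : Base A₀ →* Base A₀}
    (hA : ∀ c, f (of (Sum.inl c)) = of (Sum.inl c)) (ha : f (a A₀) = a A₀)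
    (hb : f (b A₀) = b A₀)
    (hu : f ((u A₀)⁻¹ * v A₀ * u A₀) = (u A₀)⁻¹ * v A₀ * u A₀) :
    Function.Bijective f ∧ (f (y A₀) = y A₀ ∨ f (y A₀) = (y A₀)⁻¹) := by
  have hv : f (v A₀) = word (f (y A₀)) := by simp only [v, word, map_mul, map_inv, ha, hb]
  have hy : f (y A₀) = y A₀ ∨ f (y A₀) = (y A₀)⁻¹ := by
    refine eq_or_eq_inv_of_conj (x := u A₀ * (f (u A₀))⁻¹) ?_
    rw [map_mul, map_mul, map_inv, hv] at hu
    calc _ = u A₀ * ((f (u A₀))⁻¹ * word (f (y A₀)) * f (u A₀)) * (u A₀)⁻¹ := by group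
      _ = v A₀ := by rw [hu]; group
  refine ⟨?_, hy⟩
  rcases hy with hy | hy
  · exact bijective_of_fixes hA ha hb hy hu
  · have h2 : Function.Bijective (f.comp f) := by
      refine bijective_of_fixes (fun c => ?_) ?_ ?_ ?_ ?_
      · rw [MonoidHom.comp_apply, hA, hA]
      · rw [MonoidHom.comp_apply, ha, ha]
      · rw [MonoidHom.comp_apply, hb, hb]
      · rw [MonoidHom.comp_apply, hy, map_inv, hy, inv_inv]
      · rw [MonoidHom.comp_apply, hu, hu]
    rw [MonoidHom.coe_comp] at h2
    exact ⟨h2.1.of_comp, h2.2.of_comp⟩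

section iso

variable {φ : ↥(Subgroup.zpowers (u A₀)) ≃* ↥(Subgroup.zpowers (v A₀))}

variable (A₀) in
/-- The embedding of `H` into the free group on `A₀ ∪ {a, b, t, y}`, where the letter `t` is
called `u`: it sends `u` to `t⁻¹ v t` and fixes the other generators. -/
def baseToFree : Base A₀ →* Base A₀ :=
  FreeGroup.lift (Sum.elim (fun c => of (Sum.inl c))
    ![a A₀, b A₀, (u A₀)⁻¹ * v A₀ * u A₀, y A₀])

theorem baseToFree_inl (c : A₀) : baseToFree A₀ (of (Sum.inl c)) = of (Sum.inl c) :=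
  FreeGroup.lift_apply_of

theorem baseToFree_a : baseToFree A₀ (a A₀) = a A₀ := FreeGroup.lift_apply_of

theorem baseToFree_b : baseToFree A₀ (b A₀) = b A₀ := FreeGroup.lift_apply_of

theorem baseToFree_u : baseToFree A₀ (u A₀) = (u A₀)⁻¹ * v A₀ * u A₀ := FreeGroup.lift_apply_of

theorem baseToFree_y : baseToFree A₀ (y A₀) = y A₀ := FreeGroup.lift_apply_of

theorem baseToFree_v : baseToFree A₀ (v A₀) = v A₀ := by
  simp only [v, map_mul, map_inv, baseToFree_a, baseToFree_b, baseToFree_y]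

theorem exists_zpow_eq
    (hφ : φ ⟨u A₀, Subgroup.mem_zpowers (u A₀)⟩ = ⟨v A₀, Subgroup.mem_zpowers (v A₀)⟩)
    (z : Subgroup.zpowers (u A₀)) : ∃ n : ℤ, (z : Base A₀) = u A₀ ^ n ∧
      (φ z : Base A₀) = v A₀ ^ n := by
  obtain ⟨_, n, rfl⟩ := z
  refine ⟨n, rfl, ?_⟩
  have : (⟨u A₀ ^ n, n, rfl⟩ : Subgroup.zpowers (u A₀)) =
      ⟨u A₀, Subgroup.mem_zpowers (u A₀)⟩ ^ n := rfl
  change (φ ⟨u A₀ ^ n, n, rfl⟩ : Base A₀) = v A₀ ^ n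
  rw [this, map_zpow, hφ]
  rfl

/-- The homomorphism from `F` to the free group on `A₀ ∪ {a, b, t, y}`. -/
def extToFree
    (hφ : φ ⟨u A₀, Subgroup.mem_zpowers (u A₀)⟩ = ⟨v A₀, Subgroup.mem_zpowers (v A₀)⟩) :
    Ext A₀ φ →* Base A₀ :=
  HNNExtension.lift (baseToFree A₀) (u A₀) fun z => by
    obtain ⟨n, h₁, h₂⟩ := exists_zpow_eq hφ z
    rw [h₁, h₂, map_zpow, map_zpow, baseToFree_u, baseToFree_v]
    have : ((u A₀)⁻¹ * v A₀ * u A₀) ^ n = (u A₀)⁻¹ * v A₀ ^ n * u A₀ := by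
      simpa using conj_zpow (i := n) (a := (u A₀)⁻¹) (b := v A₀)
    rw [this]
    group

variable (φ) in
/-- The homomorphism from the free group on `A₀ ∪ {a, b, t, y}` to `F`. -/
def freeToExt : Base A₀ →* Ext A₀ φ :=
  FreeGroup.lift (Sum.elim (fun c => ofH A₀ φ (of (Sum.inl c)))
    ![ofH A₀ φ (a A₀), ofH A₀ φ (b A₀), HNNExtension.t, ofH A₀ φ (y A₀)])

theorem freeToExt_inl (c : A₀) : freeToExt φ (of (Sum.inl c)) = ofH A₀ φ (of (Sum.inl c)) :=
  FreeGroup.lift_apply_of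

theorem freeToExt_a : freeToExt φ (a A₀) = ofH A₀ φ (a A₀) := FreeGroup.lift_apply_of

theorem freeToExt_b : freeToExt φ (b A₀) = ofH A₀ φ (b A₀) := FreeGroup.lift_apply_of

theorem freeToExt_u : freeToExt φ (u A₀) = HNNExtension.t := FreeGroup.lift_apply_of

theorem freeToExt_y : freeToExt φ (y A₀) = ofH A₀ φ (y A₀) := FreeGroup.lift_apply_of

theorem freeToExt_v : freeToExt φ (v A₀) = ofH A₀ φ (v A₀) := by
  simp only [v, map_mul, map_inv, freeToExt_a, freeToExt_b, freeToExt_y]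

variable (hφ : φ ⟨u A₀, Subgroup.mem_zpowers (u A₀)⟩ = ⟨v A₀, Subgroup.mem_zpowers (v A₀)⟩)

theorem extToFree_ofH (h : Base A₀) : extToFree hφ (ofH A₀ φ h) = baseToFree A₀ h :=
  HNNExtension.lift_of ..

theorem extToFree_t : extToFree hφ HNNExtension.t = u A₀ :=
  HNNExtension.lift_t ..

theorem t_mul_ofH_u
    (hφ : φ ⟨u A₀, Subgroup.mem_zpowers (u A₀)⟩ = ⟨v A₀, Subgroup.mem_zpowers (v A₀)⟩) :
    (HNNExtension.t : Ext A₀ φ) * ofH A₀ φ (u A₀) = ofH A₀ φ (v A₀) * HNNExtension.t := by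
  have := HNNExtension.t_mul_of (φ := φ) ⟨u A₀, Subgroup.mem_zpowers (u A₀)⟩
  rwa [hφ] at this

/-- `F` is free on `A₀ ∪ {a, b, t, y}`. -/
def extEquivFree : Ext A₀ φ ≃* Base A₀ :=
  MonoidHom.toMulEquiv (extToFree hφ) (freeToExt φ)
    (by
      refine HNNExtension.hom_ext ?_ ?_
      · ext x
        change freeToExt φ (extToFree hφ (ofH A₀ φ (of x))) = ofH A₀ φ (of x)
        rw [extToFree_ofH]
        rcases x with x | i
        · rw [baseToFree_inl, freeToExt_inl]
        · fin_cases i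
          · change freeToExt φ (baseToFree A₀ (a A₀)) = ofH A₀ φ (a A₀)
            rw [baseToFree_a, freeToExt_a]
          · change freeToExt φ (baseToFree A₀ (b A₀)) = ofH A₀ φ (b A₀)
            rw [baseToFree_b, freeToExt_b]
          · change freeToExt φ (baseToFree A₀ (u A₀)) = ofH A₀ φ (u A₀)
            rw [baseToFree_u, map_mul, map_mul, map_inv, freeToExt_u, freeToExt_v, mul_assoc,
              ← t_mul_ofH_u hφ, inv_mul_cancel_left]
          · change freeToExt φ (baseToFree A₀ (y A₀)) = ofH A₀ φ (y A₀)
            rw [baseToFree_y, freeToExt_y]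
      · change freeToExt φ (extToFree hφ HNNExtension.t) = HNNExtension.t
        rw [extToFree_t, freeToExt_u])
    (by
      ext x
      change extToFree hφ (freeToExt φ (of x)) = of x
      rcases x with x | i
      · rw [freeToExt_inl, extToFree_ofH, baseToFree_inl]
      · fin_cases i
        · change extToFree hφ (freeToExt φ (a A₀)) = a A₀
          rw [freeToExt_a, extToFree_ofH, baseToFree_a]
        · change extToFree hφ (freeToExt φ (b A₀)) = b A₀
          rw [freeToExt_b, extToFree_ofH, baseToFree_b]
        · change extToFree hφ (freeToExt φ (u A₀)) = u A₀
          rw [freeToExt_u, extToFree_t]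
        · change extToFree hφ (freeToExt φ (y A₀)) = y A₀
          rw [freeToExt_y, extToFree_ofH, baseToFree_y])

theorem extEquivFree_ofH (h : Base A₀) : extEquivFree hφ (ofH A₀ φ h) = baseToFree A₀ h :=
  extToFree_ofH hφ h

end iso

theorem ofH_fixed_of_fixed {φ : ↥(Subgroup.zpowers (u A₀)) ≃* ↥(Subgroup.zpowers (v A₀))}
    {f : Ext A₀ φ →* Ext A₀ φ} (hA : ∀ x ∈ (A A₀).map (ofH A₀ φ), f x = x)
    (hy : f (ofH A₀ φ (y A₀)) = ofH A₀ φ (y A₀)) (h : Base A₀) :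
    f (ofH A₀ φ h) = ofH A₀ φ h := by
  have hmem : ∀ z ∈ (Set.range fun x : A₀ => FreeGroup.of (Sum.inl x)) ∪ {a A₀, b A₀, u A₀},
      f (ofH A₀ φ z) = ofH A₀ φ z :=
    fun z hz => hA _ (Subgroup.mem_map_of_mem _ (Subgroup.subset_closure hz))
  have : f.comp (ofH A₀ φ) = ofH A₀ φ := by
    ext x
    rcases x with x | i
    · exact hmem _ (Or.inl ⟨x, rfl⟩)
    · fin_cases i
      exacts [hmem _ (Or.inr (Or.inl rfl)), hmem _ (Or.inr (Or.inr (Or.inl rfl))),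
        hmem _ (Or.inr (Or.inr (Or.inr rfl))), hy]
  exact DFunLike.congr_fun this h

end HNNCounterexample

open HNNCounterexample in
/-- With `H` the free group on `A₀ ∪ {a,b,u,y}`, `A = ⟨A₀,a,b,u⟩`,
`v = a y b y a y⁻¹ b y⁻¹` and `F = ⟨H, t | u^t = v⟩` the HNN extension of `H` along the
isomorphism `⟨u⟩ ≃ ⟨v⟩` sending `u` to `v`, the group `F` is free of rank `|A₀| + 4`,
every endomorphism of `F` fixing `A` pointwise is an automorphism, and moreover any such
endomorphism whose restriction to `H` is not the identity sends `y` to `y⁻¹`. -/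
theorem hnn_counterexample_endomorphisms (A₀ : Type) [Finite A₀]
    (φ : ↥(Subgroup.zpowers (u A₀)) ≃* ↥(Subgroup.zpowers (v A₀)))
    (hφ : φ ⟨u A₀, Subgroup.mem_zpowers (u A₀)⟩ = ⟨v A₀, Subgroup.mem_zpowers (v A₀)⟩) :
    Nonempty (Ext A₀ φ ≃* FreeGroup (A₀ ⊕ Fin 4)) ∧
    ∀ f : Ext A₀ φ →* Ext A₀ φ,
      (∀ x ∈ (A A₀).map (ofH A₀ φ), f x = x) →
      Function.Bijective f ∧
      ((¬ ∀ h : Base A₀, f (ofH A₀ φ h) = ofH A₀ φ h) →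
        f (ofH A₀ φ (y A₀)) = (ofH A₀ φ (y A₀))⁻¹) := by
  refine ⟨⟨extEquivFree hφ⟩, fun f hf => ?_⟩
  set e := extEquivFree hφ with he
  let g : Base A₀ →* Base A₀ := (e.toMonoidHom.comp f).comp e.symm.toMonoidHom
  have hg : ∀ h, f (ofH A₀ φ h) = ofH A₀ φ h → g (baseToFree A₀ h) = baseToFree A₀ h := by
    intro h hfix
    change e (f (e.symm (baseToFree A₀ h))) = baseToFree A₀ h
    rw [← extEquivFree_ofH hφ, ← he, e.symm_apply_apply, hfix]
  have hgA : ∀ z ∈ (Set.range fun x : A₀ => FreeGroup.of (Sum.inl x)) ∪ {a A₀, b A₀, u A₀},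
      g (baseToFree A₀ z) = baseToFree A₀ z :=
    fun z hz => hg z (hf _ (Subgroup.mem_map_of_mem _ (Subgroup.subset_closure hz)))
  have hgy : g (y A₀) = e (f (ofH A₀ φ (y A₀))) := by
    change e (f (e.symm (y A₀))) = _
    nth_rw 1 [← baseToFree_y]
    rw [← extEquivFree_ofH hφ, ← he, e.symm_apply_apply]
  have hey : e (ofH A₀ φ (y A₀)) = y A₀ := by rw [he, extEquivFree_ofH, baseToFree_y]
  obtain ⟨hbij, hy⟩ := bijective_and_eq_or_eq_inv (f := g)
    (fun c => by simpa only [baseToFree_inl] using hgA _ (Or.inl ⟨c, rfl⟩))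
    (by simpa only [baseToFree_a] using hgA _ (Or.inr (Or.inl rfl)))
    (by simpa only [baseToFree_b] using hgA _ (Or.inr (Or.inr (Or.inl rfl))))
    (by simpa only [baseToFree_u] using hgA _ (Or.inr (Or.inr (Or.inr rfl))))
  refine ⟨?_, fun hne => ?_⟩
  · have hfg : ⇑f = e.symm ∘ g ∘ e := by
      funext x
      simp [g]
    rw [hfg]
    exact e.symm.bijective.comp (hbij.comp e.bijective)
  · rw [hgy] at hy
    rcases hy with hy | hy
    · exact absurd (ofH_fixed_of_fixed hf (e.injective (hy.trans hey.symm))) hne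
    · exact e.injective (by rw [hy, map_inv, hey])
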